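/- Let μ ∈ ℝ^n, σ > 0, and let P = Measure.pi (fun i => gaussianReal (μ_i) σ²) be the law on ℝ^n of a Gaussian vector with mean μ and covariance σ²·I_n. For any nonzero η ∈ ℝ^n: (i) the pushforward of P under the map y ↦ ηᵀy equals gaussianReal (ηᵀμ) (σ²·‖η‖₂²); and (ii) under P, the random variables y ↦ ηᵀy and y ↦ y − (ηᵀy/‖η‖₂²)·η are independent. -/

import Mathlib

open scoped BigOperators
open MeasureTheory ProbabilityTheory

section PiGaussianReal

variable {ι : Type*} [Fintype ι] (m : ι → ℝ) (v : ι → NNReal)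

lemma hasLaw_eval_pi_gaussianReal (i : ι) :
    HasLaw (fun y : ι → ℝ => y i) (gaussianReal (m i) (v i))
      (Measure.pi fun i => gaussianReal (m i) (v i)) :=
  (measurePreserving_eval (fun i => gaussianReal (m i) (v i)) i).hasLaw

lemma hasGaussianLaw_id_pi_gaussianReal :
    HasGaussianLaw (fun y : ι → ℝ => y) (Measure.pi fun i => gaussianReal (m i) (v i)) := by
  exact iIndepFun.hasGaussianLaw (X := fun i (y : ι → ℝ) => y i)
    (fun i => (hasLaw_eval_pi_gaussianReal m v i).hasGaussianLaw)
    (iIndepFun_pi (X := fun _ => id) fun _ => aemeasurable_id)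

lemma hasGaussianLaw_sum_pi_gaussianReal (a : ι → ℝ) :
    HasGaussianLaw (fun y : ι → ℝ => ∑ i, a i * y i)
      (Measure.pi fun i => gaussianReal (m i) (v i)) := by
  simpa [sum_apply] using (hasGaussianLaw_id_pi_gaussianReal m v).map_fun
    (∑ i, a i • ContinuousLinearMap.proj (R := ℝ) (φ := fun _ : ι => ℝ) i)

lemma memLp_two_eval_pi_gaussianReal (i : ι) :
    MemLp (fun y : ι → ℝ => y i) 2 (Measure.pi fun i => gaussianReal (m i) (v i)) :=
  (hasLaw_eval_pi_gaussianReal m v i).hasGaussianLaw.memLp_two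

lemma covariance_eval_pi_gaussianReal [DecidableEq ι] (i j : ι) :
    cov[fun y : ι → ℝ => y i, fun y => y j; Measure.pi fun i => gaussianReal (m i) (v i)]
      = if i = j then (v i : ℝ) else 0 := by
  split_ifs with h
  · subst h
    rw [covariance_self (measurable_pi_apply i).aemeasurable,
      (hasLaw_eval_pi_gaussianReal m v i).variance_eq,
      variance_id_gaussianReal]
  · have hind := iIndepFun_pi (μ := fun i => gaussianReal (m i) (v i)) (X := fun _ => id)
      fun _ => aemeasurable_id
    exact (hind.indepFun h).covariance_eq_zero (memLp_two_eval_pi_gaussianReal m v i)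
      (memLp_two_eval_pi_gaussianReal m v j)

lemma covariance_sum_eval_pi_gaussianReal (a : ι → ℝ) (j : ι) :
    cov[fun y : ι → ℝ => ∑ i, a i * y i, fun y => y j;
      Measure.pi fun i => gaussianReal (m i) (v i)] = a j * v j := by
  classical
  rw [covariance_fun_sum_left (fun i => (memLp_two_eval_pi_gaussianReal m v i).const_mul _)
    (memLp_two_eval_pi_gaussianReal m v j)]
  simp [covariance_const_mul_left, covariance_eval_pi_gaussianReal]

lemma variance_sum_pi_gaussianReal (a : ι → ℝ) :
    Var[fun y : ι → ℝ => ∑ i, a i * y i; Measure.pi fun i => gaussianReal (m i) (v i)]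
      = ∑ i, a i ^ 2 * v i := by
  rw [← covariance_self (hasGaussianLaw_sum_pi_gaussianReal m v a).aemeasurable, covariance_fun_sum_right
    (fun i => (memLp_two_eval_pi_gaussianReal m v i).const_mul _)
    (memLp_finsetSum _ fun i _ => (memLp_two_eval_pi_gaussianReal m v i).const_mul _)]
  simp only [covariance_const_mul_right, covariance_sum_eval_pi_gaussianReal]
  exact Finset.sum_congr rfl fun i _ => by ring

lemma map_sum_pi_gaussianReal (a : ι → ℝ) :
    (Measure.pi fun i => gaussianReal (m i) (v i)).map (fun y : ι → ℝ => ∑ i, a i * y i)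
      = gaussianReal (∑ i, a i * m i) (∑ i, a i ^ 2 * v i : ℝ).toNNReal := by
  rw [(hasGaussianLaw_sum_pi_gaussianReal m v a).map_eq_gaussianReal,
    variance_sum_pi_gaussianReal, integral_finsetSum _ fun i _ =>
      ((memLp_two_eval_pi_gaussianReal m v i).integrable (by norm_num)).const_mul _]
  simp only [integral_const_mul, (hasLaw_eval_pi_gaussianReal m v _).integral_eq,
    integral_id_gaussianReal]

end PiGaussianReal

/-- For `y ~ N(μ, σ²Iₙ)` and `η ≠ 0`: (i) `ηᵀy ~ N(ηᵀμ, σ²‖η‖₂²)`; (ii) `ηᵀy` is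
independent of the orthogonal component `y − (ηᵀy/‖η‖₂²)·η`. -/
theorem gaussian_linear_form_and_orthogonal_independence {n : ℕ}
    (μ : Fin n → ℝ) (σ : ℝ) (hσ : 0 < σ) (η : Fin n → ℝ) (hη : η ≠ 0) :
    (Measure.map (fun y : Fin n → ℝ => ∑ i, η i * y i)
        (Measure.pi fun i => gaussianReal (μ i) (σ ^ 2).toNNReal)
      = gaussianReal (∑ i, η i * μ i) ((σ ^ 2 * ∑ i, η i ^ 2).toNNReal)) ∧
    IndepFun (fun y : Fin n → ℝ => ∑ i, η i * y i)
      (fun y : Fin n → ℝ => y - ((∑ i, η i * y i) / (∑ i, η i ^ 2)) • η)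
      (Measure.pi fun i => gaussianReal (μ i) (σ ^ 2).toNNReal) := by
  have hv : ((σ ^ 2).toNNReal : ℝ) = σ ^ 2 := Real.coe_toNNReal _ (sq_nonneg σ)
  constructor
  · rw [map_sum_pi_gaussianReal, hv, ← Finset.sum_mul, mul_comm]
  have hs : ∑ i, η i ^ 2 ≠ 0 := by
    contrapose! hη
    ext i
    simpa using (Finset.sum_eq_zero_iff_of_nonneg fun i _ => sq_nonneg (η i)).1 hη i
  set s := ∑ i, η i ^ 2 with hs_def
  set P := Measure.pi fun i => gaussianReal (μ i) (σ ^ 2).toNNReal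
  let L : (Fin n → ℝ) →L[ℝ] ℝ :=
    ∑ i, η i • ContinuousLinearMap.proj (R := ℝ) (φ := fun _ : Fin n => ℝ) i
  have hL (y : Fin n → ℝ) : L y = ∑ i, η i * y i := by simp [L]
  have hjoint : HasGaussianLaw (fun y : Fin n → ℝ =>
      (fun _ : Unit => ∑ i, η i * y i, fun j => y j - s⁻¹ * η j * ∑ i, η i * y i)) P := by
    have h := (hasGaussianLaw_id_pi_gaussianReal μ fun _ => (σ ^ 2).toNNReal).map_fun
      ((ContinuousLinearMap.pi fun _ : Unit => L).prod (ContinuousLinearMap.pi fun j =>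
        ContinuousLinearMap.proj (R := ℝ) (φ := fun _ : Fin n => ℝ) j - (s⁻¹ * η j) • L))
    refine h.congr (.of_forall fun y => Prod.ext ?_ ?_)
    · ext; exact hL y
    · ext j; simp [hL]
  have hmem := (hasGaussianLaw_sum_pi_gaussianReal μ (fun _ => (σ ^ 2).toNNReal) η).memLp_two
  have hind := HasGaussianLaw.indepFun_of_covariance_eval
    (X := fun (_ : Unit) (y : Fin n → ℝ) => ∑ i, η i * y i)
    (Y := fun j (y : Fin n → ℝ) => y j - s⁻¹ * η j * ∑ i, η i * y i) hjoint fun _ j => by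
      rw [covariance_fun_sub_right hmem (memLp_two_eval_pi_gaussianReal _ _ j)
        (hmem.const_mul _), covariance_const_mul_right, covariance_self hmem.aemeasurable,
        covariance_sum_eval_pi_gaussianReal, variance_sum_pi_gaussianReal, ← Finset.sum_mul,
        ← hs_def]
      field_simp
      ring
  have hY : (fun y : Fin n → ℝ => y - ((∑ i, η i * y i) / s) • η)
      = fun y j => y j - s⁻¹ * η j * ∑ i, η i * y i := by
    funext y j
    simp only [Pi.sub_apply, Pi.smul_apply, smul_eq_mul]
    ring
  rw [hY]
  exact hind.comp (measurable_pi_apply ()) measurable_id
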